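/- arXiv:1406.2982 — 2 statements merged into one kernel-verified Lean document; each statement's English description precedes it below -/
import Mathlib

section
/- For all sets A, B ⊆ ℕ: B is mod-finite reducible to A if and only if R̃(B) is coarsely reducible to R̃(A). Hence the map S ↦ R̃(S) induces an embedding of the mod-finite degrees into the coarse degrees. -/
open Filter

/-- A finite record of oracle query answers: a finite list of (position, bit) pairs. -/
abbrev FinInfo : Type := List (ℕ × Bool)

/-- Two finite query-answer records are compatible if they agree wherever both answer. -/
def FinInfo.Compatible (σ τ : FinInfo) : Prop :=
  ∀ p ∈ σ, ∀ q ∈ τ, p.1 = q.1 → p.2 = q.2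

/-- The answers recorded in `σ` are exactly those given by the characteristic
function of the set `C`. -/
def AgreesSet (σ : FinInfo) (C : Set ℕ) : Prop :=
  ∀ p ∈ σ, (p.2 = true ↔ p.1 ∈ C)

/-- The answers recorded in `σ` are all given by the partial oracle `g`. -/
def AgreesPart (σ : FinInfo) (g : ℕ →. Bool) : Prop :=
  ∀ p ∈ σ, p.2 ∈ g p.1

/-- `g` is a partial oracle for the set `A`: a partial function from `ℕ` to `Bool`
agreeing with the characteristic function of `A` on its domain. -/
def IsPartialOracle (g : ℕ →. Bool) (A : Set ℕ) : Prop :=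
  ∀ n b, b ∈ g n → (b = true ↔ n ∈ A)

/-- The domain of a partial oracle. -/
def pDom (g : ℕ →. Bool) : Set ℕ := {n | (g n).Dom}

/-- A Turing functional (oracle Turing machine program), presented as a computable
enumeration of axioms `(σ, n, b)`, meaning: if the oracle answers the queries
recorded in `σ` as `σ` prescribes, then the machine halts on input `n` with
output `b`.  Oracle queries are made in parallel, so with a partial oracle the
machine halts on `n` iff some axiom for `n` is answered by the partial oracle.
Determinism of the machine is reflected in the requirement that axioms with
compatible query answers give equal outputs. -/
structure TuringFunctional where
  axs : ℕ → Option (FinInfo × ℕ × Bool)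
  axs_computable : Computable axs
  consistent : ∀ k₁ k₂ σ₁ σ₂ n b₁ b₂, axs k₁ = some (σ₁, n, b₁) →
    axs k₂ = some (σ₂, n, b₂) → σ₁.Compatible σ₂ → b₁ = b₂

namespace TuringFunctional

/-- `Φ^C(n)` halts with output `b` (total oracle `C`). -/
def HaltsT (Φ : TuringFunctional) (C : Set ℕ) (n : ℕ) (b : Bool) : Prop :=
  ∃ k σ, Φ.axs k = some (σ, n, b) ∧ AgreesSet σ C

/-- `Φ^g(n)` halts with output `b` (partial oracle `g`). -/
def HaltsP (Φ : TuringFunctional) (g : ℕ →. Bool) (n : ℕ) (b : Bool) : Prop :=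
  ∃ k σ, Φ.axs k = some (σ, n, b) ∧ AgreesPart σ g

/-- `Φ^C` is total. -/
def TotalOn (Φ : TuringFunctional) (C : Set ℕ) : Prop := ∀ n, ∃ b, Φ.HaltsT C n b

/-- The set `{n : Φ^C(n) = B(n)}` on which `Φ^C` halts and agrees with the
characteristic function of `B`. -/
def AgreeSet (Φ : TuringFunctional) (C B : Set ℕ) : Set ℕ :=
  {n | ∃ b, Φ.HaltsT C n b ∧ (b = true ↔ n ∈ B)}

/-- `Φ^A = B`: with oracle `A`, `Φ` is total and computes the characteristic
function of `B`. -/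
def FunEq (Φ : TuringFunctional) (A B : Set ℕ) : Prop :=
  Φ.TotalOn A ∧ ∀ n b, Φ.HaltsT A n b → (b = true ↔ n ∈ B)

/-- `Φ^g ≃ B`: every halting output of `Φ` with partial oracle `g` agrees with
the characteristic function of `B`. -/
def PAgrees (Φ : TuringFunctional) (g : ℕ →. Bool) (B : Set ℕ) : Prop :=
  ∀ n b, Φ.HaltsP g n b → (b = true ↔ n ∈ B)

/-- The domain of `Φ^g`. -/
def PDomain (Φ : TuringFunctional) (g : ℕ →. Bool) : Set ℕ :=
  {n | ∃ b, Φ.HaltsP g n b}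

/-- The axiom with index `k` applies to oracle `C` on input `n`. -/
def AppliesAt (Φ : TuringFunctional) (C : Set ℕ) (n k : ℕ) : Prop :=
  ∃ σ b, Φ.axs k = some (σ, n, b) ∧ AgreesSet σ C

/-- The (halting) computation of `Φ^C(n)` queries the oracle bit `C(m)`:
the first axiom in the enumeration that applies to `C` on input `n`
records an answer to a query at position `m`. -/
def QueriesAt (Φ : TuringFunctional) (C : Set ℕ) (n m : ℕ) : Prop :=
  ∃ k σ b, Φ.axs k = some (σ, n, b) ∧ AgreesSet σ C ∧
    (∀ k' < k, ¬ Φ.AppliesAt C n k') ∧ ∃ p ∈ σ, p.1 = m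

end TuringFunctional

/-- `D ⊆ ℕ` has (asymptotic) density 1. -/
def DensityOne (D : Set ℕ) : Prop :=
  Filter.Tendsto (fun n : ℕ => ((D ∩ Set.Iio n).ncard : ℝ) / n) Filter.atTop (nhds 1)

/-- `B ≤₁ A`: 1-reducibility. -/
def OneRed (B A : Set ℕ) : Prop :=
  ∃ f : ℕ → ℕ, Computable f ∧ Function.Injective f ∧ ∀ n, n ∈ B ↔ f n ∈ A

/-- `B ≤_T A`: Turing reducibility. -/
def TuringRed (B A : Set ℕ) : Prop :=
  ∃ Φ : TuringFunctional, Φ.FunEq A B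

/-- `B ≤_mr A`: mod-recursive reducibility. -/
def ModRecRed (B A : Set ℕ) : Prop :=
  ∃ Φ : TuringFunctional, Φ.FunEq A B ∧
    ∀ C : Set ℕ, ComputablePred (fun n => (n ∈ C ↔ n ∈ A)) →
      Φ.TotalOn C ∧ ComputablePred (fun n => n ∈ Φ.AgreeSet C B)

/-- `B ≤_mf A`: mod-finite reducibility. -/
def ModFinRed (B A : Set ℕ) : Prop :=
  ∃ Φ : TuringFunctional, Φ.FunEq A B ∧
    ∀ C : Set ℕ, {n | ¬ (n ∈ C ↔ n ∈ A)}.Finite →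
      Φ.TotalOn C ∧ (Φ.AgreeSet C B)ᶜ.Finite

/-- `B ≤_cor A`: coarse reducibility. -/
def CoarseRed (B A : Set ℕ) : Prop :=
  ∃ Φ : TuringFunctional,
    ∀ C : Set ℕ, DensityOne {n | n ∈ C ↔ n ∈ A} →
      Φ.TotalOn C ∧ DensityOne (Φ.AgreeSet C B)

/-- `B ≤_cf A`: cofinite reducibility. -/
def CofinRed (B A : Set ℕ) : Prop :=
  ∃ Φ : TuringFunctional, Φ.FunEq A B ∧
    ∀ g : ℕ →. Bool, IsPartialOracle g A → (pDom g)ᶜ.Finite →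
      Φ.PAgrees g B ∧ (Φ.PDomain g)ᶜ.Finite

/-- `B ≤_g A`: generic reducibility. -/
def GenericRed (B A : Set ℕ) : Prop :=
  ∃ Φ : TuringFunctional, Φ.FunEq A B ∧
    ∀ g : ℕ →. Bool, IsPartialOracle g A → DensityOne (pDom g) →
      Φ.PAgrees g B ∧ DensityOne (Φ.PDomain g)

/-- `B ≤_ii A`: infinite-information reducibility. -/
def IIRed (B A : Set ℕ) : Prop :=
  ∃ Φ : TuringFunctional,
    ∀ g : ℕ →. Bool, IsPartialOracle g A → (pDom g).Infinite →
      Φ.PAgrees g B ∧ (Φ.PDomain g).Infinite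

/-- `B ≤_ubfb A`: use-bounded-from-below reducibility. -/
def UbfbRed (B A : Set ℕ) : Prop :=
  ∃ Φ : TuringFunctional, Φ.FunEq A B ∧
    ∀ m : ℕ, ∀ᶠ n in Filter.atTop, ¬ Φ.QueriesAt A n m

/-- `R(S) = {2^n · m : n ∈ S, m odd}`. -/
def Rmap (S : Set ℕ) : Set ℕ :=
  {x | ∃ n ∈ S, ∃ m : ℕ, Odd m ∧ x = 2 ^ n * m}

/-- `R̃(S) = {2^n + m : n ∈ S, m < 2^n}`. -/
def Rtilde (S : Set ℕ) : Set ℕ :=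
  {x | ∃ n ∈ S, ∃ m : ℕ, m < 2 ^ n ∧ x = 2 ^ n + m}

/-- The Turing join `A ⊕ B`. -/
def turingJoin (A B : Set ℕ) : Set ℕ :=
  {x | (∃ n ∈ A, x = 2 * n) ∨ (∃ n ∈ B, x = 2 * n + 1)}

/-- `x ↦ log₂ x` is primitive recursive. -/
theorem primrec_log_two : Primrec (Nat.log 2) := by
  have hpow : Primrec₂ ((· ^ ·) : ℕ → ℕ → ℕ) := Primrec₂.unpaired'.1 Nat.Primrec.pow
  have h : Primrec fun x => Nat.findGreatest (fun k => 2 ^ k ≤ x) x :=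
    Primrec.nat_findGreatest Primrec.id
      (Primrec.nat_le.comp (hpow.comp (Primrec.const 2) Primrec.snd) Primrec.fst)
  refine h.of_eq fun x => ?_
  rw [Nat.findGreatest_eq_iff]
  refine ⟨Nat.log_le_self 2 x, fun h0 => ?_, fun n hn _ => ?_⟩
  · exact Nat.pow_log_le_self 2 (by rintro rfl; simp at h0)
  · exact not_le.2 (Nat.lt_pow_of_log_lt (by norm_num) hn)

theorem log_two_pow_add {n m : ℕ} (hm : m < 2 ^ n) : Nat.log 2 (2 ^ n + m) = n :=
  Nat.log_eq_of_pow_le_of_lt_pow (by omega) (by rw [pow_succ]; omega)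

theorem mem_Rtilde_iff {S : Set ℕ} {x : ℕ} : x ∈ Rtilde S ↔ x ≠ 0 ∧ Nat.log 2 x ∈ S := by
  constructor
  · rintro ⟨n, hn, m, hm, rfl⟩
    exact ⟨by positivity, by rwa [log_two_pow_add hm]⟩
  · rintro ⟨h0, hx⟩
    have h1 := Nat.pow_log_le_self 2 h0
    have h2 := Nat.lt_pow_succ_log_self (b := 2) (by norm_num) x
    rw [pow_succ] at h2
    exact ⟨_, hx, x - 2 ^ Nat.log 2 x, by omega, by omega⟩

/-- The graph of the characteristic function of `C`. -/
def charGraph (C : Set ℕ) (n : ℕ) (b : Bool) : Prop := b = true ↔ n ∈ C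

/-- The relation computed on numbers by reading `Q` at the exponent of their dyadic block. -/
def blockLift (Q : ℕ → Bool → Prop) (x : ℕ) (b : Bool) : Prop :=
  (x = 0 ∧ b = false) ∨ (x ≠ 0 ∧ Q (Nat.log 2 x) b)

open Classical in
/-- A majority of the dyadic block `[2 ^ n, 2 ^ (n + 1))` is related to `b` by `Q`;
ties are resolved in favour of `false`. -/
def BlockMajority (Q : ℕ → Bool → Prop) (n : ℕ) (b : Bool) : Prop :=
  2 ^ n < 2 * ((Finset.range (2 ^ n)).filter fun m => Q (2 ^ n + m) b).card +
    if b = true then 0 else 1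

theorem BlockMajority.mono {Q Q' : ℕ → Bool → Prop} {n : ℕ} {b : Bool}
    (h : ∀ m < 2 ^ n, Q (2 ^ n + m) b → Q' (2 ^ n + m) b) (hQ : BlockMajority Q n b) :
    BlockMajority Q' n b := by
  classical
  have : ((Finset.range (2 ^ n)).filter fun m => Q (2 ^ n + m) b).card ≤
      ((Finset.range (2 ^ n)).filter fun m => Q' (2 ^ n + m) b).card := by
    refine Finset.card_le_card fun m hm => ?_
    simp only [Finset.mem_filter, Finset.mem_range] at hm ⊢
    exact ⟨hm.1, h m hm.1 hm.2⟩
  unfold BlockMajority at *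
  omega

theorem BlockMajority.exists_common {Q Q' : ℕ → Bool → Prop} {n : ℕ} {b b' : Bool}
    (h : BlockMajority Q n b) (h' : BlockMajority Q' n b') (hb : b ≠ b') :
    ∃ x, Q x b ∧ Q' x b' := by
  classical
  by_contra! hne
  have hdisj : Disjoint ((Finset.range (2 ^ n)).filter fun m => Q (2 ^ n + m) b)
      ((Finset.range (2 ^ n)).filter fun m => Q' (2 ^ n + m) b') :=
    Finset.disjoint_filter.2 fun m _ h1 h2 => hne _ h1 h2
  have hcard := Finset.card_le_card (Finset.union_subset
    (Finset.filter_subset (fun m => Q (2 ^ n + m) b) (Finset.range (2 ^ n)))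
    (Finset.filter_subset (fun m => Q' (2 ^ n + m) b') (Finset.range (2 ^ n))))
  rw [Finset.card_union_of_disjoint hdisj, Finset.card_range] at hcard
  unfold BlockMajority at h h'
  cases b <;> cases b' <;> simp at hb h h' <;> omega

theorem exists_blockMajority {Q : ℕ → Bool → Prop} {n : ℕ} (h : ∀ x, ∃ b, Q x b) :
    ∃ b, BlockMajority Q n b := by
  classical
  by_contra! hne
  have h1 := hne true
  have h2 := hne false
  have hsub : Finset.range (2 ^ n) ⊆
      ((Finset.range (2 ^ n)).filter fun m => Q (2 ^ n + m) true) ∪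
      ((Finset.range (2 ^ n)).filter fun m => Q (2 ^ n + m) false) := by
    intro m hm
    obtain ⟨b, hb⟩ := h (2 ^ n + m)
    cases b <;> simp_all
  have hcard := (Finset.card_le_card hsub).trans (Finset.card_union_le _ _)
  rw [Finset.card_range] at hcard
  unfold BlockMajority at h1 h2
  simp at h1 h2
  omega

theorem blockMajority_charGraph (C : Set ℕ) :
    BlockMajority (charGraph C) = charGraph {n | BlockMajority (charGraph C) n true} := by
  have huniq : ∀ n, BlockMajority (charGraph C) n false →
      ¬ BlockMajority (charGraph C) n true := fun n h h' => by
    obtain ⟨x, h1, h2⟩ := h.exists_common h' (by simp)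
    simp_all [charGraph]
  have htot : ∀ n, ∃ b, BlockMajority (charGraph C) n b := fun n => by
    classical exact exists_blockMajority fun x => ⟨decide (x ∈ C), by simp [charGraph]⟩
  funext n b
  apply propext
  cases b with
  | true => simp [charGraph]
  | false =>
    refine ⟨fun h => by simpa [charGraph] using huniq n h, fun h => ?_⟩
    obtain ⟨b, hb⟩ := htot n
    cases b with
    | false => exact hb
    | true => exact absurd hb (by simpa [charGraph] using h)

theorem blockLift_charGraph (C : Set ℕ) : blockLift (charGraph C) = charGraph (Rtilde C) := by
  funext x b
  apply propext
  unfold blockLift charGraph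
  rw [mem_Rtilde_iff]
  cases b <;> by_cases hx : x = 0 <;> simp [hx]

/-- A set of density one eventually contains more than half of each dyadic block. -/
theorem DensityOne.eventually_half_block {D : Set ℕ} (hD : DensityOne D)
    [DecidablePred (· ∈ D)] :
    ∀ᶠ n in atTop,
      2 ^ n < 2 * ((Finset.range (2 ^ n)).filter fun m => 2 ^ n + m ∈ D).card := by
  have hpow : Tendsto (fun n : ℕ => 2 ^ (n + 1)) atTop atTop :=
    (tendsto_pow_atTop_atTop_of_one_lt (by norm_num : 1 < 2)).comp (tendsto_add_atTop_nat 1)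
  filter_upwards [(hD.comp hpow).eventually (lt_mem_nhds (by norm_num : (3 / 4 : ℝ) < 1))]
    with n hn
  have hsub : D ∩ Set.Iio (2 ^ (n + 1)) ⊆ ((Finset.range (2 ^ n) ∪
      ((Finset.range (2 ^ n)).filter fun m => 2 ^ n + m ∈ D).image (2 ^ n + ·) :
        Finset ℕ) : Set ℕ) := by
    rintro x ⟨hxD, hx⟩
    simp only [Set.mem_Iio, pow_succ] at hx
    simp only [Finset.coe_union, Set.mem_union, Finset.mem_coe, Finset.mem_range,
      Finset.mem_image, Finset.mem_filter]
    by_cases hlt : x < 2 ^ n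
    · exact Or.inl hlt
    · have : 2 ^ n + (x - 2 ^ n) = x := by omega
      exact Or.inr ⟨x - 2 ^ n, ⟨by omega, by rwa [this]⟩, this⟩
  have hcard := (Set.ncard_le_ncard hsub (Finset.finite_toSet _))
  rw [Set.ncard_coe_finset] at hcard
  have hcard' := hcard.trans ((Finset.card_union_le _ _).trans
    (Nat.add_le_add_left Finset.card_image_le _))
  rw [Finset.card_range] at hcard'
  simp only [Function.comp] at hn
  rw [lt_div_iff₀ (by positivity)] at hn
  push_cast at hn
  have hcast : ((D ∩ Set.Iio (2 ^ (n + 1))).ncard : ℝ) ≤ 2 ^ n +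
      (((Finset.range (2 ^ n)).filter fun m => 2 ^ n + m ∈ D).card : ℝ) := by
    exact_mod_cast hcard'
  rw [pow_succ] at hn
  have : (2 ^ n : ℝ) < 2 * (((Finset.range (2 ^ n)).filter fun m => 2 ^ n + m ∈ D).card : ℝ) := by
    linarith
  exact_mod_cast this

open Classical in
theorem DensityOne.eventually_blockMajority {D S : Set ℕ} {Q : ℕ → Bool → Prop}
    (hD : DensityOne D) (h : ∀ x ∈ D, Q x (decide (x ∈ Rtilde S))) :
    ∀ᶠ n in atTop, BlockMajority Q n (decide (n ∈ S)) := by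
  filter_upwards [hD.eventually_half_block] with n hn
  have hsub : ((Finset.range (2 ^ n)).filter fun m => 2 ^ n + m ∈ D) ⊆
      (Finset.range (2 ^ n)).filter fun m => Q (2 ^ n + m) (decide (n ∈ S)) := by
    intro m hm
    simp only [Finset.mem_filter, Finset.mem_range] at hm ⊢
    have hQ := h _ hm.2
    have h0 : 2 ^ n + m ≠ 0 := by positivity
    simp only [mem_Rtilde_iff, log_two_pow_add hm.1, ne_eq, h0, not_false_eq_true,
      true_and] at hQ
    exact ⟨hm.1, hQ⟩
  have hcard := Finset.card_le_card hsub
  unfold BlockMajority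
  omega

theorem densityOne_of_finite_compl {D : Set ℕ} (h : Dᶜ.Finite) : DensityOne D := by
  have hlow : Tendsto (fun n : ℕ => 1 - (Dᶜ.ncard : ℝ) / n) atTop (nhds 1) := by
    simpa using tendsto_const_nhds.sub (tendsto_const_div_atTop_nhds_zero_nat (Dᶜ.ncard : ℝ))
  refine tendsto_of_tendsto_of_tendsto_of_le_of_le' hlow tendsto_const_nhds ?_ ?_
  · filter_upwards [eventually_gt_atTop 0] with n hn
    have hn' : (0 : ℝ) < n := by exact_mod_cast hn
    have hcov : Set.Iio n ⊆ (D ∩ Set.Iio n) ∪ Dᶜ := fun x hx => by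
      by_cases hxD : x ∈ D
      · exact Or.inl ⟨hxD, hx⟩
      · exact Or.inr hxD
    have hcard := (Set.ncard_le_ncard hcov
      (((Set.finite_Iio n).inter_of_right D).union h)).trans (Set.ncard_union_le _ _)
    rw [Set.ncard_Iio_nat] at hcard
    have : (n : ℝ) ≤ (D ∩ Set.Iio n).ncard + Dᶜ.ncard := by exact_mod_cast hcard
    rw [one_sub_div hn'.ne', div_le_div_iff_of_pos_right hn']
    linarith
  · filter_upwards with n
    have hcard := Set.ncard_le_ncard (Set.inter_subset_right (s := D) (t := Set.Iio n))
      (Set.finite_Iio n)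
    rw [Set.ncard_Iio_nat] at hcard
    exact div_le_one_of_le₀ (by exact_mod_cast hcard) (Nat.cast_nonneg n)

theorem finite_setOf_log_two_mem {S : Set ℕ} (h : S.Finite) : {x | Nat.log 2 x ∈ S}.Finite := by
  obtain ⟨M, hM⟩ := h.bddAbove
  refine (Set.finite_Iio (2 ^ (M + 1))).subset fun x hx => ?_
  exact Nat.lt_pow_of_log_lt (by norm_num) (Nat.lt_succ_of_le (hM hx))

/-- An oracle operator presented by stages: `Q τ s n b` says that the query answers `τ`
are seen to yield value `b` at `n` within `s` steps. -/
structure IsStagedOperator (Q : FinInfo → ℕ → ℕ → Bool → Prop) : Prop where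
  primrec : PrimrecPred fun y : (FinInfo × ℕ) × ℕ × Bool => Q y.1.1 y.1.2 y.2.1 y.2.2
  mono : ∀ {τ τ' : FinInfo} {s s' n b}, τ ⊆ τ' → s ≤ s' → Q τ s n b → Q τ' s' n b
  consistent : ∀ {τ τ' : FinInfo} {s s' n b b'}, τ.Compatible τ' →
    Q τ s n b → Q τ' s' n b' → b = b'

/-- The relation computed by a staged operator relative to the oracle `C`. -/
def stageLimit (Q : FinInfo → ℕ → ℕ → Bool → Prop) (C : Set ℕ) (n : ℕ) (b : Bool) : Prop :=
  ∃ τ s, AgreesSet τ C ∧ Q τ s n b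

open Classical in
/-- The record of the first `J` answers of the oracle `C`. -/
noncomputable def initialAnswers (C : Set ℕ) (J : ℕ) : FinInfo :=
  (List.range J).map fun j => (j, decide (j ∈ C))

theorem agreesSet_initialAnswers (C : Set ℕ) (J : ℕ) : AgreesSet (initialAnswers C J) C := by
  intro p hp
  simp only [initialAnswers, List.mem_map] at hp
  obtain ⟨j, -, rfl⟩ := hp
  simp

theorem AgreesSet.eventually_subset {τ : FinInfo} {C : Set ℕ} (h : AgreesSet τ C) :
    ∀ᶠ J in atTop, τ ⊆ initialAnswers C J := by
  have hall : ∀ p ∈ τ, ∀ᶠ J in atTop, p ∈ initialAnswers C J := by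
    intro p hp
    filter_upwards [eventually_gt_atTop p.1] with J hJ
    simp only [initialAnswers, List.mem_map, List.mem_range]
    refine ⟨p.1, hJ, Prod.ext rfl ?_⟩
    have := h p hp
    cases hb : p.2 <;> simp_all
  have := (Filter.eventually_all_finite (List.finite_toSet τ)).2 hall
  filter_upwards [this] with J hJ p hp using hJ p hp

theorem AgreesSet.compatible {σ τ : FinInfo} {C : Set ℕ} (hσ : AgreesSet σ C)
    (hτ : AgreesSet τ C) : σ.Compatible τ := fun p hp q hq hpq => by
  have h1 := hσ p hp
  have h2 := hτ q hq
  rw [hpq, ← h2] at h1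
  exact Bool.eq_iff_iff.2 h1

namespace IsStagedOperator

variable {Q : FinInfo → ℕ → ℕ → Bool → Prop}

theorem eventually_of_stageLimit (hQ : IsStagedOperator Q) {C : Set ℕ} {n : ℕ} {b : Bool}
    (h : stageLimit Q C n b) : ∀ᶠ J in atTop, Q (initialAnswers C J) J n b := by
  obtain ⟨τ, s, hτ, h⟩ := h
  filter_upwards [hτ.eventually_subset, eventually_ge_atTop s] with J h1 h2
  exact hQ.mono h1 h2 h

/-- Every staged operator is computed by a Turing functional. -/
theorem exists_functional (hQ : IsStagedOperator Q) :
    ∃ Ψ : TuringFunctional, ∀ C, Ψ.HaltsT C = stageLimit Q C := by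
  obtain ⟨hdec, hprim⟩ := hQ.primrec
  have hax : Primrec fun k : ℕ => (Encodable.decode (α := (FinInfo × ℕ) × ℕ × Bool) k).bind
      fun y => if Q y.1.1 y.1.2 y.2.1 y.2.2 then some (y.1.1, y.2.1, y.2.2) else none := by
    refine Primrec.option_bind Primrec.decode ?_
    refine Primrec.to₂ (f := fun q : ℕ × ((FinInfo × ℕ) × ℕ × Bool) =>
      if Q q.2.1.1 q.2.1.2 q.2.2.1 q.2.2.2 then some (q.2.1.1, q.2.2.1, q.2.2.2) else none)
      (Primrec.ite (hQ.primrec.comp Primrec.snd) ?_ (Primrec.const none))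
    exact Primrec.option_some.comp
      (((Primrec.fst.comp Primrec.fst).comp Primrec.snd).pair (Primrec.snd.comp Primrec.snd))
  have hmem : ∀ k σ n b, ((Encodable.decode (α := (FinInfo × ℕ) × ℕ × Bool) k).bind
      fun y => if Q y.1.1 y.1.2 y.2.1 y.2.2 then some (y.1.1, y.2.1, y.2.2) else none) =
        some (σ, n, b) → ∃ s, Q σ s n b := by
    intro k σ n b h
    obtain ⟨⟨⟨τ, s⟩, m, c⟩, -, h⟩ := Option.bind_eq_some_iff.1 h
    split_ifs at h with hq
    simp only [Option.some.injEq, Prod.mk.injEq] at h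
    obtain ⟨rfl, rfl, rfl⟩ := h
    exact ⟨s, hq⟩
  refine ⟨⟨_, hax.to_comp, ?_⟩, ?_⟩
  · intro k₁ k₂ σ₁ σ₂ n b₁ b₂ h₁ h₂ hc
    obtain ⟨s₁, h₁⟩ := hmem _ _ _ _ h₁
    obtain ⟨s₂, h₂⟩ := hmem _ _ _ _ h₂
    exact hQ.consistent hc h₁ h₂
  · intro C
    funext n b
    apply propext
    constructor
    · rintro ⟨k, σ, h, hσ⟩
      obtain ⟨s, h⟩ := hmem _ _ _ _ h
      exact ⟨σ, s, hσ, h⟩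
    · rintro ⟨τ, s, hτ, h⟩
      refine ⟨Encodable.encode ((τ, s), n, b), τ, ?_, hτ⟩
      simp [h]

end IsStagedOperator

/-- The identity operator. -/
theorem isStagedOperator_mem : IsStagedOperator fun τ _ n b => (n, b) ∈ τ where
  primrec := by
    have h : PrimrecRel fun (L : FinInfo) (p : ℕ × Bool) => ∃ a ∈ L, a = p :=
      PrimrecRel.exists_mem_list Primrec.eq
    exact (h.comp (Primrec.fst.comp Primrec.fst) Primrec.snd).of_eq fun y => by simp
  mono hτ _ h := hτ h
  consistent hc h h' := hc _ h _ h' rfl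

theorem stageLimit_mem (C : Set ℕ) :
    stageLimit (fun τ _ n b => (n, b) ∈ τ) C = charGraph C := by
  funext n b
  apply propext
  constructor
  · rintro ⟨τ, s, hτ, h⟩
    exact hτ _ h
  · intro h
    exact ⟨[(n, b)], 0, by simpa [AgreesSet, charGraph] using h, by simp⟩

namespace IsStagedOperator

variable {Q : FinInfo → ℕ → ℕ → Bool → Prop}

theorem blockLift (hQ : IsStagedOperator Q) : IsStagedOperator fun τ s => blockLift (Q τ s) where
  primrec := by
    have hx : Primrec fun y : (FinInfo × ℕ) × ℕ × Bool => y.2.1 :=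
      Primrec.fst.comp Primrec.snd
    have hb : Primrec fun y : (FinInfo × ℕ) × ℕ × Bool => y.2.2 :=
      Primrec.snd.comp Primrec.snd
    have h0 := Primrec.eq.comp hx (Primrec.const 0)
    exact (h0.and (Primrec.eq.comp hb (Primrec.const false))).or
      (h0.not.and (hQ.primrec.comp (Primrec.fst.pair ((primrec_log_two.comp hx).pair hb))))
  mono hτ hs h := h.imp id (And.imp id (hQ.mono hτ hs))
  consistent hc h h' := by
    rcases h with ⟨h0, h⟩ | ⟨h0, h⟩ <;> rcases h' with ⟨h0', h'⟩ | ⟨h0', h'⟩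
    · rw [h, h']
    · exact absurd h0 h0'
    · exact absurd h0' h0
    · exact hQ.consistent hc h h'

theorem stageLimit_blockLift (C : Set ℕ) :
    stageLimit (fun τ s => _root_.blockLift (Q τ s)) C = _root_.blockLift (stageLimit Q C) := by
  funext x b
  apply propext
  constructor
  · rintro ⟨τ, s, hτ, h⟩
    exact h.imp id (And.imp id fun h => ⟨τ, s, hτ, h⟩)
  · rintro (h | ⟨h0, τ, s, hτ, h⟩)
    · exact ⟨[], 0, by simp [AgreesSet], Or.inl h⟩
    · exact ⟨τ, s, hτ, Or.inr ⟨h0, h⟩⟩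

theorem blockMajority (hQ : IsStagedOperator Q) :
    IsStagedOperator fun τ s => BlockMajority (Q τ s) where
  primrec := by
    classical
    have hpow : Primrec fun y : (FinInfo × ℕ) × ℕ × Bool => 2 ^ y.2.1 :=
      (Primrec₂.unpaired'.1 Nat.Primrec.pow).comp (Primrec.const 2)
        (Primrec.fst.comp Primrec.snd)
    have hb : Primrec fun y : (FinInfo × ℕ) × ℕ × Bool => y.2.2 :=
      Primrec.snd.comp Primrec.snd
    have hR : PrimrecRel fun (m : ℕ) (y : (FinInfo × ℕ) × ℕ × Bool) =>
        Q y.1.1 y.1.2 (2 ^ y.2.1 + m) y.2.2 :=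
      hQ.primrec.comp ((Primrec.fst.comp Primrec.snd).pair
        ((Primrec.nat_add.comp (hpow.comp Primrec.snd) Primrec.fst).pair (hb.comp Primrec.snd)))
    have hcount := Primrec.list_length.comp
      ((PrimrecRel.listFilter hR).comp (Primrec.list_range.comp hpow) Primrec.id)
    exact Primrec.nat_lt.comp hpow (Primrec.nat_add.comp (Primrec.nat_double.comp hcount)
      (Primrec.ite (Primrec.eq.comp hb (Primrec.const true)) (Primrec.const 0)
        (Primrec.const 1)))
  mono hτ hs := BlockMajority.mono fun _ _ => hQ.mono hτ hs
  consistent hc h h' := by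
    by_contra hb
    obtain ⟨x, h1, h2⟩ := h.exists_common h' hb
    exact hb (hQ.consistent hc h1 h2)

theorem stageLimit_blockMajority (hQ : IsStagedOperator Q) (C : Set ℕ) :
    stageLimit (fun τ s => BlockMajority (Q τ s)) C = BlockMajority (stageLimit Q C) := by
  funext n b
  apply propext
  constructor
  · rintro ⟨τ, s, hτ, h⟩
    exact h.mono fun m _ h => ⟨τ, s, hτ, h⟩
  · intro h
    have hev : ∀ᶠ J in atTop, ∀ m ∈ Finset.range (2 ^ n), stageLimit Q C (2 ^ n + m) b →
        Q (initialAnswers C J) J (2 ^ n + m) b :=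
      (Finset.eventually_all _).2 fun m _ =>
        eventually_imp_distrib_left.2 hQ.eventually_of_stageLimit
    obtain ⟨J, hJ⟩ := hev.exists
    exact ⟨_, J, agreesSet_initialAnswers C J, h.mono fun m hm => hJ m (Finset.mem_range.2 hm)⟩

/-- Overwriting the values of an operator below `N` by those of a fixed set. -/
theorem patch (hQ : IsStagedOperator Q) (B : Set ℕ) (N : ℕ) :
    IsStagedOperator fun τ s n b => (n, b) ∈ initialAnswers B N ∨ N ≤ n ∧ Q τ s n b where
  primrec := by
    have h : PrimrecPred fun y : (FinInfo × ℕ) × ℕ × Bool => y.2 ∈ initialAnswers B N :=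
      ((PrimrecRel.exists_mem_list Primrec.eq).comp (Primrec.const (initialAnswers B N))
        Primrec.snd).of_eq fun y => by simp
    exact h.or ((Primrec.nat_le.comp (Primrec.const N) (Primrec.fst.comp Primrec.snd)).and
      hQ.primrec)
  mono hτ hs h := h.imp id (And.imp id (hQ.mono hτ hs))
  consistent {_ _ _ _ _ _ _} hc h h' := by
    have hlt : ∀ {n b}, (n, b) ∈ initialAnswers B N → n < N := fun h => by
      simp only [initialAnswers, List.mem_map, List.mem_range, Prod.mk.injEq] at h
      obtain ⟨_, h, rfl, -⟩ := h
      exact h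
    have hB := agreesSet_initialAnswers B N
    rcases h with h | ⟨h0, h⟩ <;> rcases h' with h' | ⟨h0', h'⟩
    · exact hB.compatible hB _ h _ h' rfl
    · exact absurd (hlt h) h0'.not_gt
    · exact absurd (hlt h') h0.not_gt
    · exact hQ.consistent hc h h'

theorem stageLimit_patch (B C : Set ℕ) (N n : ℕ) (b : Bool) :
    stageLimit (fun τ s n b => (n, b) ∈ initialAnswers B N ∨ N ≤ n ∧ Q τ s n b) C n b ↔
      (n, b) ∈ initialAnswers B N ∨ N ≤ n ∧ stageLimit Q C n b := by
  constructor
  · rintro ⟨τ, s, hτ, h⟩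
    exact h.imp id (And.imp id fun h => ⟨τ, s, hτ, h⟩)
  · rintro (h | ⟨h0, τ, s, hτ, h⟩)
    · exact ⟨[], 0, by simp [AgreesSet], Or.inl h⟩
    · exact ⟨τ, s, hτ, Or.inr ⟨h0, h⟩⟩

end IsStagedOperator

namespace TuringFunctional

/-- The axioms of a Turing functional form the union of a primitive recursive increasing
sequence of finite lists. -/
theorem exists_primrec_stages (Φ : TuringFunctional) :
    ∃ F : ℕ → List (FinInfo × ℕ × Bool), Primrec F ∧
      (∀ s t, s ≤ t → F s ⊆ F t) ∧ ∀ a, (∃ k, Φ.axs k = some a) ↔ ∃ s, a ∈ F s := by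
  obtain ⟨c, hc⟩ := Nat.Partrec.Code.exists_code.1 Φ.axs_computable
  have heval : ∀ k, Nat.Partrec.Code.eval c k = Part.some (Encodable.encode (Φ.axs k)) := by
    intro k
    simp [hc]
  let g : ℕ → Option (FinInfo × ℕ × Bool) := fun i =>
    (Nat.Partrec.Code.evaln i.unpair.1 c i.unpair.2).bind fun v =>
      (Encodable.decode (α := Option (FinInfo × ℕ × Bool)) v).bind id
  have hg : Primrec g := by
    refine Primrec.option_bind (Nat.Partrec.Code.primrec_evaln.comp
      (((Primrec.fst.comp Primrec.unpair).pair (Primrec.const c)).pair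
        (Primrec.snd.comp Primrec.unpair))) ?_
    exact (Primrec.option_bind (Primrec.decode.comp Primrec.snd) Primrec.snd.to₂).to₂
  refine ⟨fun s => (List.range s).filterMap g,
    Primrec.listFilterMap Primrec.list_range (hg.comp Primrec.snd).to₂, ?_, fun a => ?_⟩
  · intro s t hst a ha
    simp only [List.mem_filterMap, List.mem_range] at ha ⊢
    obtain ⟨i, hi, h⟩ := ha
    exact ⟨i, hi.trans_le hst, h⟩
  · simp only [List.mem_filterMap, List.mem_range]
    constructor
    · rintro ⟨k, hk⟩
      have hmem : Encodable.encode (some a) ∈ Nat.Partrec.Code.eval c k := by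
        rw [heval, hk]; exact Part.mem_some _
      obtain ⟨t, ht⟩ := Nat.Partrec.Code.evaln_complete.1 hmem
      refine ⟨Nat.pair t k + 1, Nat.pair t k, Nat.lt_succ_self _, ?_⟩
      simp only [g, Nat.unpair_pair, Option.mem_def.1 ht, Option.bind_some, Encodable.encodek, id]
    · rintro ⟨s, i, -, h⟩
      obtain ⟨v, hv, h⟩ := Option.bind_eq_some_iff.1 h
      have hv' := Nat.Partrec.Code.evaln_sound (Option.mem_def.2 hv)
      rw [heval, Part.mem_some_iff] at hv'
      subst hv'
      exact ⟨i.unpair.2, by simpa using h⟩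

theorem HaltsT.unique {Φ : TuringFunctional} {C : Set ℕ} {n : ℕ} {b b' : Bool}
    (h : Φ.HaltsT C n b) (h' : Φ.HaltsT C n b') : b = b' := by
  obtain ⟨k, σ, hk, hσ⟩ := h
  obtain ⟨k', σ', hk', hσ'⟩ := h'
  exact Φ.consistent _ _ _ _ _ _ _ hk hk' (hσ.compatible hσ')

open Classical in
theorem mem_AgreeSet_iff {Φ : TuringFunctional} {C B : Set ℕ} {n : ℕ} :
    n ∈ Φ.AgreeSet C B ↔ Φ.HaltsT C n (decide (n ∈ B)) := by
  constructor
  · rintro ⟨b, hb, h⟩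
    have : b = decide (n ∈ B) := Bool.eq_iff_iff.2 (by simpa using h)
    rwa [← this]
  · exact fun h => ⟨_, h, by simp⟩

/-- A Turing functional may be composed with a staged operator. -/
theorem exists_comp (Φ : TuringFunctional) {Q : FinInfo → ℕ → ℕ → Bool → Prop}
    (hQ : IsStagedOperator Q) :
    ∃ P, IsStagedOperator P ∧
      ∀ C D, stageLimit Q C = charGraph D → stageLimit P C = Φ.HaltsT D := by
  obtain ⟨F, hF, hmono, hmem⟩ := Φ.exists_primrec_stages
  refine ⟨fun τ s n b => ∃ a ∈ F s, a.2 = (n, b) ∧ ∀ p ∈ a.1, Q τ s p.1 p.2, ⟨?_, ?_, ?_⟩, ?_⟩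
  · have h1 : PrimrecRel fun (p : ℕ × Bool) (y : (FinInfo × ℕ) × ℕ × Bool) =>
        Q y.1.1 y.1.2 p.1 p.2 :=
      hQ.primrec.comp ((Primrec.fst.comp Primrec.snd).pair Primrec.fst)
    have h2 : PrimrecRel fun (a : FinInfo × ℕ × Bool) (y : (FinInfo × ℕ) × ℕ × Bool) =>
        a.2 = y.2 ∧ ∀ p ∈ a.1, Q y.1.1 y.1.2 p.1 p.2 :=
      (Primrec.eq.comp (Primrec.snd.comp Primrec.fst) (Primrec.snd.comp Primrec.snd)).and
        ((PrimrecRel.forall_mem_list h1).comp (Primrec.fst.comp Primrec.fst) Primrec.snd)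
    exact (PrimrecRel.exists_mem_list h2).comp (hF.comp (Primrec.snd.comp Primrec.fst))
      Primrec.id
  · rintro τ τ' s s' n b hτ hs ⟨a, ha, hab, h⟩
    exact ⟨a, hmono _ _ hs ha, hab, fun p hp => hQ.mono hτ hs (h p hp)⟩
  · rintro τ τ' s s' n b b' hc ⟨⟨σ, _⟩, ha, rfl, h⟩ ⟨⟨σ', _⟩, ha', rfl, h'⟩
    obtain ⟨k, hk⟩ := (hmem _).2 ⟨_, ha⟩
    obtain ⟨k', hk'⟩ := (hmem _).2 ⟨_, ha'⟩
    refine Φ.consistent _ _ _ _ _ _ _ hk hk' ?_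
    rintro ⟨m, c⟩ hp ⟨m', c'⟩ hq (rfl : m = m')
    exact hQ.consistent hc (h _ hp) (h' _ hq)
  · intro C D hCD
    funext n b
    apply propext
    constructor
    · rintro ⟨τ, s, hτ, ⟨σ, _⟩, ha, rfl, h⟩
      obtain ⟨k, hk⟩ := (hmem _).2 ⟨_, ha⟩
      refine ⟨k, σ, hk, fun p hp => ?_⟩
      change charGraph D p.1 p.2
      rw [← hCD]
      exact ⟨τ, s, hτ, h p hp⟩
    · rintro ⟨k, σ, hk, hσ⟩
      obtain ⟨s, hs⟩ := (hmem _).1 ⟨k, hk⟩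
      have hall : ∀ p ∈ σ, ∀ᶠ J in atTop, Q (initialAnswers C J) J p.1 p.2 := fun p hp =>
        hQ.eventually_of_stageLimit (by rw [hCD]; exact hσ p hp)
      obtain ⟨J, hJ, hsJ⟩ := (((Filter.eventually_all_finite (List.finite_toSet σ)).2 hall).and
        (eventually_ge_atTop s)).exists
      exact ⟨_, J, agreesSet_initialAnswers C J, _, hmono _ _ hsJ hs, rfl, hJ⟩

end TuringFunctional

theorem ModFinRed.coarseRed_Rtilde {A B : Set ℕ} (h : ModFinRed B A) :
    CoarseRed (Rtilde B) (Rtilde A) := by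
  classical
  obtain ⟨Φ, -, hΦ⟩ := h
  obtain ⟨P, hP, hlim⟩ := Φ.exists_comp isStagedOperator_mem.blockMajority
  obtain ⟨Ψ, hΨ⟩ := hP.blockLift.exists_functional
  refine ⟨Ψ, fun C hC => ?_⟩
  let D : Set ℕ := {n | BlockMajority (charGraph C) n true}
  have hD : BlockMajority (charGraph C) = charGraph D := blockMajority_charGraph C
  have hPD : stageLimit P C = Φ.HaltsT D := hlim C D (by
    rw [isStagedOperator_mem.stageLimit_blockMajority, stageLimit_mem, hD])
  have hΨC : Ψ.HaltsT C = blockLift (Φ.HaltsT D) := by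
    rw [hΨ, IsStagedOperator.stageLimit_blockLift, hPD]
  have hDA : {n | ¬ (n ∈ D ↔ n ∈ A)}.Finite := by
    have hev := hC.eventually_blockMajority (Q := charGraph C) (S := A) fun x hx => by
      simpa [charGraph] using (Iff.symm hx)
    rw [← Nat.cofinite_eq_atTop] at hev
    refine hev.subset fun n hn hmaj => hn ?_
    rw [hD] at hmaj
    simpa [charGraph] using hmaj.symm
  obtain ⟨htot, hfin⟩ := hΦ D hDA
  refine ⟨fun x => ?_, densityOne_of_finite_compl ?_⟩
  · rw [hΨC]
    by_cases hx : x = 0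
    · exact ⟨false, Or.inl ⟨hx, rfl⟩⟩
    · obtain ⟨b, hb⟩ := htot (Nat.log 2 x)
      exact ⟨b, Or.inr ⟨hx, hb⟩⟩
  · refine (finite_setOf_log_two_mem hfin).subset fun x hx hmem => hx ?_
    rw [TuringFunctional.mem_AgreeSet_iff] at hmem ⊢
    rw [hΨC, mem_Rtilde_iff]
    by_cases hx0 : x = 0
    · exact Or.inl ⟨hx0, by simp [hx0]⟩
    · exact Or.inr ⟨hx0, by simpa [hx0] using hmem⟩

theorem CoarseRed.modFinRed {A B : Set ℕ} (h : CoarseRed (Rtilde B) (Rtilde A)) :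
    ModFinRed B A := by
  classical
  obtain ⟨Φ, hΦ⟩ := h
  have hfinΦ : ∀ C : Set ℕ, {n | ¬ (n ∈ C ↔ n ∈ A)}.Finite → Φ.TotalOn (Rtilde C) ∧
      ∀ᶠ n in atTop, BlockMajority (Φ.HaltsT (Rtilde C)) n (decide (n ∈ B)) := by
    intro C hC
    obtain ⟨htot, hdens⟩ := hΦ (Rtilde C) (densityOne_of_finite_compl
      ((finite_setOf_log_two_mem hC).subset fun x hx hlog => hx (by
        simp only [Set.mem_ofPred_eq, mem_Rtilde_iff]
        rw [hlog])))
    exact ⟨htot, hdens.eventually_blockMajority fun x hx => TuringFunctional.mem_AgreeSet_iff.1 hx⟩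
  obtain ⟨N, hN⟩ := eventually_atTop.1 (hfinΦ A (by simp)).2
  obtain ⟨P, hP, hlim⟩ := Φ.exists_comp isStagedOperator_mem.blockLift
  obtain ⟨Ψ, hΨ⟩ := (hP.blockMajority.patch B N).exists_functional
  have hΨC : ∀ C n b, Ψ.HaltsT C n b ↔ (n, b) ∈ initialAnswers B N ∨
      N ≤ n ∧ BlockMajority (Φ.HaltsT (Rtilde C)) n b := by
    intro C n b
    rw [hΨ, IsStagedOperator.stageLimit_patch, hP.stageLimit_blockMajority,
      hlim C (Rtilde C) (by
        rw [IsStagedOperator.stageLimit_blockLift, stageLimit_mem, blockLift_charGraph])]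
  have hsmall : ∀ n < N, ∀ C, Ψ.HaltsT C n (decide (n ∈ B)) := fun n hn C =>
    (hΨC _ _ _).2 (Or.inl (List.mem_map.2 ⟨n, List.mem_range.2 hn, rfl⟩))
  have htotal : ∀ C : Set ℕ, {n | ¬ (n ∈ C ↔ n ∈ A)}.Finite → Ψ.TotalOn C := by
    intro C hC n
    rcases lt_or_ge n N with hn | hn
    · exact ⟨_, hsmall n hn C⟩
    · obtain ⟨b, hb⟩ := exists_blockMajority (n := n) (hfinΦ C hC).1
      exact ⟨b, (hΨC _ _ _).2 (Or.inr ⟨hn, hb⟩)⟩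
  refine ⟨Ψ, ⟨htotal A (by simp), fun n b hb => ?_⟩, fun C hC => ⟨htotal C hC, ?_⟩⟩
  · have hB : Ψ.HaltsT A n (decide (n ∈ B)) := by
      rcases lt_or_ge n N with hn | hn
      · exact hsmall n hn A
      · exact (hΨC _ _ _).2 (Or.inr ⟨hn, hN n hn⟩)
    rw [hb.unique hB]
    simp
  · have hev := (hfinΦ C hC).2.and (eventually_ge_atTop N)
    rw [← Nat.cofinite_eq_atTop] at hev
    refine hev.subset fun n hn hmaj => hn ?_
    exact TuringFunctional.mem_AgreeSet_iff.2 ((hΨC _ _ _).2 (Or.inr ⟨hmaj.2, hmaj.1⟩))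

theorem mod_finite_red_iff_coarse_red_Rtilde (A B : Set ℕ) :
    ModFinRed B A ↔ CoarseRed (Rtilde B) (Rtilde A) :=
  ⟨ModFinRed.coarseRed_Rtilde, CoarseRed.modFinRed⟩
end

section
/- There exist sets A, B ⊆ ℕ such that B is generically reducible to A but B is not coarsely reducible to A. -/
open Filter

open Nat.Partrec (Code)
open Encodable

/-- The block of `x`: the `n` with `2 ^ n ≤ x + 1 < 2 ^ (n + 1)`. -/
def dyadicBlock (x : ℕ) : ℕ := Nat.findGreatest (fun k => 2 ^ k ≤ x + 1) x

/-- The column of `x`: the exponent of `2` in `x + 1`. -/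
def dyadicColumn (x : ℕ) : ℕ := Nat.findGreatest (fun k => 2 ^ k ∣ x + 1) x

theorem primrec_two_pow : Primrec fun k : ℕ => 2 ^ k :=
  (Primrec₂.unpaired'.1 Nat.Primrec.pow).comp (Primrec.const 2) Primrec.id

theorem primrec_dyadicBlock : Primrec dyadicBlock :=
  Primrec.nat_findGreatest Primrec.id
    (Primrec.nat_le.comp (primrec_two_pow.comp Primrec.snd) (Primrec.succ.comp Primrec.fst))

theorem primrec_dyadicColumn : Primrec dyadicColumn := by
  refine Primrec.nat_findGreatest (p := fun x k => 2 ^ k ∣ x + 1) Primrec.id ?_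
  refine PrimrecPred.of_eq (p := fun a : ℕ × ℕ => (a.1 + 1) % 2 ^ a.2 = 0)
    (Primrec.eq.comp (Primrec.nat_mod.comp (Primrec.succ.comp Primrec.fst)
      (primrec_two_pow.comp Primrec.snd)) (Primrec.const 0)) ?_
  exact fun a => (Nat.dvd_iff_mod_eq_zero ..).symm

theorem two_pow_dyadicColumn_dvd (x : ℕ) : 2 ^ dyadicColumn x ∣ x + 1 :=
  Nat.findGreatest_spec (P := fun k => 2 ^ k ∣ x + 1) (Nat.zero_le x) (by simp)

theorem lt_two_pow_dyadicBlock_succ (x : ℕ) : x + 1 < 2 ^ (dyadicBlock x + 1) := by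
  by_contra! h
  have h1 : dyadicBlock x + 1 ≤ x := by
    have := (dyadicBlock x + 1).lt_two_pow_self
    omega
  have := Nat.le_findGreatest (P := fun k => 2 ^ k ≤ x + 1) h1 h
  simp only [dyadicBlock] at this
  omega

theorem dyadicBlock_eq {x n : ℕ} (h₁ : 2 ^ n ≤ x + 1) (h₂ : x + 1 < 2 ^ (n + 1)) :
    dyadicBlock x = n := by
  have hn : n ≤ x := by
    have := n.lt_two_pow_self
    omega
  refine le_antisymm ?_ (Nat.le_findGreatest hn h₁)
  have h := Nat.findGreatest_spec (P := fun k => 2 ^ k ≤ x + 1) (Nat.zero_le x) (by simp)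
  have := (Nat.pow_lt_pow_iff_right (a := 2) (by norm_num)).1 (h.trans_lt h₂)
  exact Nat.lt_succ_iff.1 this

theorem dyadicColumn_eq {x e m : ℕ} (h : x + 1 = 2 ^ e * (2 * m + 1)) : dyadicColumn x = e := by
  have he : e ≤ x := by
    have := e.lt_two_pow_self
    have : 2 ^ e ≤ x + 1 := h ▸ Nat.le_mul_of_pos_right _ (by omega)
    omega
  refine le_antisymm ?_ (Nat.le_findGreatest he (Dvd.intro _ h.symm))
  by_contra! hlt
  have h1 : 2 ^ (e + 1) ∣ x + 1 := (pow_dvd_pow 2 hlt).trans (two_pow_dyadicColumn_dvd x)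
  rw [h, pow_succ] at h1
  have := Nat.dvd_of_mul_dvd_mul_left (by positivity) h1
  omega

/-- If every column meets the complement of `D` in finitely many blocks, then `D` has density 1. -/
theorem densityOne_of_forall_column {D : Set ℕ}
    (h : ∀ e, ∃ N, ∀ x, x ∉ D → dyadicColumn x = e → dyadicBlock x < N) : DensityOne D := by
  choose N hN using h
  unfold DensityOne
  rw [Metric.tendsto_atTop]
  intro ε hε
  obtain ⟨e, he⟩ := exists_pow_lt_of_lt_one (half_pos hε) (show (1 / 2 : ℝ) < 1 by norm_num)
  set M := (Finset.range e).sup N with hM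
  obtain ⟨K, hK⟩ := exists_nat_gt ((2 ^ M : ℝ) / (ε / 2))
  refine ⟨K + 1, fun n hn => ?_⟩
  have hsub : Set.Iio n ⊆ (D ∩ Set.Iio n) ∪
      (((Finset.range (2 ^ M) ∪ {x ∈ Finset.range n | 2 ^ e ∣ x + 1} : Finset ℕ)) : Set ℕ) := by
    intro x hx
    by_cases hxD : x ∈ D
    · exact Or.inl ⟨hxD, hx⟩
    right
    simp only [Finset.coe_union, Finset.coe_range, Finset.coe_filter, Finset.mem_range,
      Set.mem_union, Set.mem_Iio, Set.mem_ofPred_eq]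
    by_cases hc : dyadicColumn x < e
    · left
      have h1 := hN _ x hxD rfl
      have h2 : N (dyadicColumn x) ≤ M := Finset.le_sup (f := N) (Finset.mem_range.2 hc)
      have h3 := lt_two_pow_dyadicBlock_succ x
      have h4 : 2 ^ (dyadicBlock x + 1) ≤ 2 ^ M := Nat.pow_le_pow_right (by norm_num) (by omega)
      omega
    · exact Or.inr ⟨hx, (pow_dvd_pow 2 (not_lt.1 hc)).trans (two_pow_dyadicColumn_dvd x)⟩
  have hfin : (D ∩ Set.Iio n).Finite := (Set.finite_Iio n).inter_of_right D
  have hcard : n ≤ (D ∩ Set.Iio n).ncard + (2 ^ M + n / 2 ^ e) := by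
    calc n = (Set.Iio n).ncard := by simp [Set.ncard_eq_toFinset_card']
      _ ≤ _ := Set.ncard_le_ncard hsub (hfin.union (Finset.finite_toSet _))
      _ ≤ _ := Set.ncard_union_le _ _
      _ ≤ _ := by
        rw [Set.ncard_coe_finset]
        gcongr
        refine (Finset.card_union_le _ _).trans ?_
        rw [Finset.card_range, Nat.card_multiples]
  have hle : (D ∩ Set.Iio n).ncard ≤ n := by
    calc _ ≤ (Set.Iio n).ncard := Set.ncard_le_ncard Set.inter_subset_right (Set.finite_Iio n)
      _ = n := by simp [Set.ncard_eq_toFinset_card']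
  have hn0 : (0 : ℝ) < n := by exact_mod_cast (by omega : 0 < n)
  have hdiv : ((n / 2 ^ e : ℕ) : ℝ) ≤ n * (1 / 2) ^ e := by
    refine (Nat.cast_div_le).trans (le_of_eq ?_)
    push_cast
    rw [div_pow, one_pow]
    ring
  have hcard' : (n : ℝ) ≤ (D ∩ Set.Iio n).ncard + (2 ^ M + n * (1 / 2) ^ e) := by
    refine le_trans (b := (((D ∩ Set.Iio n).ncard + (2 ^ M + n / 2 ^ e) : ℕ) : ℝ))
      (by exact_mod_cast hcard) ?_
    rw [Nat.cast_add, Nat.cast_add]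
    push_cast at hdiv ⊢
    linarith
  have hle' : ((D ∩ Set.Iio n).ncard : ℝ) ≤ n := by exact_mod_cast hle
  have hKn : (2 ^ M : ℝ) < ε / 2 * n := by
    rw [div_lt_iff₀ (half_pos hε)] at hK
    have : (K : ℝ) < n := by exact_mod_cast hn
    nlinarith
  rw [Real.dist_eq, abs_lt]
  constructor
  · rw [lt_sub_iff_add_lt, lt_div_iff₀ hn0]
    nlinarith
  · rw [sub_lt_iff_lt_add, div_lt_iff₀ hn0]
    nlinarith

/-- A set of density 1 meets every column in all but finitely many blocks. -/
theorem DensityOne.eventually_exists_mem {S : Set ℕ} (hS : DensityOne S) (e : ℕ) :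
    ∀ᶠ n in atTop, ∃ x ∈ S, dyadicColumn x = e ∧ dyadicBlock x = n := by
  have hpow : Tendsto (fun n : ℕ => 2 ^ (n + 1)) atTop atTop :=
    (tendsto_pow_atTop_atTop_of_one_lt (by norm_num : 1 < 2)).comp (tendsto_add_atTop_nat 1)
  have hlim := (hS.comp hpow).eventually_const_lt
    (show (1 : ℝ) - 1 / 2 ^ (e + 2) < 1 by
      have : (0 : ℝ) < 1 / 2 ^ (e + 2) := by positivity
      linarith)
  filter_upwards [hlim, eventually_gt_atTop e] with n hn hen
  by_contra! hne
  obtain ⟨k, rfl⟩ := Nat.exists_eq_add_of_lt hen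
  let g : ℕ → ℕ := fun m => 2 ^ e * (2 * m + 1) - 1
  have hg1 : ∀ m, g m + 1 = 2 ^ e * (2 * m + 1) := fun m =>
    Nat.sub_add_cancel (Nat.mul_pos (by positivity) (by omega))
  have hginj : Function.Injective g := by
    intro a b hab
    have h1 : 2 ^ e * (2 * a + 1) = 2 ^ e * (2 * b + 1) := by rw [← hg1, ← hg1, hab]
    have := Nat.eq_of_mul_eq_mul_left (by positivity) h1
    omega
  let P : Finset ℕ := (Finset.Ico (2 ^ k) (2 ^ (k + 1))).image g
  have hPcard : P.card = 2 ^ k := by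
    rw [Finset.card_image_of_injective _ hginj, Nat.card_Ico, pow_succ]
    omega
  have hP : ∀ x ∈ P, x ∉ S ∧ x < 2 ^ (e + k + 1 + 1) := by
    intro x hx
    obtain ⟨m, hm, rfl⟩ := Finset.mem_image.1 hx
    rw [Finset.mem_Ico] at hm
    have h1 := hg1 m
    have h2 : 2 ^ (e + k + 1) ≤ g m + 1 := by
      rw [h1, add_assoc, pow_add, pow_succ]
      exact Nat.mul_le_mul_left _ (by omega)
    have h3 : g m + 1 < 2 ^ (e + k + 1 + 1) := by
      rw [h1, add_assoc, add_assoc, pow_add, ← add_assoc, pow_succ _ (k + 1)]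
      exact Nat.mul_lt_mul_of_pos_left (by omega) (by positivity)
    exact ⟨fun hxS => hne _ hxS (dyadicColumn_eq h1) (dyadicBlock_eq h2 h3), by omega⟩
  have hcard : (S ∩ Set.Iio (2 ^ (e + k + 1 + 1))).ncard + 2 ^ k ≤ 2 ^ (e + k + 1 + 1) := by
    rw [← hPcard, ← Set.ncard_coe_finset P, ← Set.ncard_union_eq
      (Set.disjoint_left.2 fun x hx hxP => (hP x hxP).1 hx.1)
      ((Set.finite_Iio _).inter_of_right S) (Finset.finite_toSet _)]
    calc _ ≤ (Set.Iio (2 ^ (e + k + 1 + 1))).ncard :=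
          Set.ncard_le_ncard
            (Set.union_subset Set.inter_subset_right fun x hx => (hP x hx).2) (Set.finite_Iio _)
      _ = _ := by simp [Set.ncard_eq_toFinset_card']
  have hcard' : ((S ∩ Set.Iio (2 ^ (e + k + 1 + 1))).ncard : ℝ) + 2 ^ k ≤ 2 ^ (e + k + 1 + 1) := by
    exact_mod_cast hcard
  simp only [Function.comp_apply, Nat.cast_pow, Nat.cast_ofNat] at hn
  rw [lt_div_iff₀ (by positivity)] at hn
  have : (1 - 1 / 2 ^ (e + 2) : ℝ) * 2 ^ (e + k + 1 + 1) = 2 ^ (e + k + 1 + 1) - 2 ^ k := by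
    have : (2 : ℝ) ^ (e + k + 1 + 1) = 2 ^ (e + 2) * 2 ^ k := by ring
    rw [this]
    field_simp
  linarith

/-- Within `n` steps, the program with index `e` halts on all inputs `z < y`. -/
def HaltsBelow (e n y : ℕ) : Prop :=
  ∀ z < y, (Code.evaln n (Denumerable.ofNat Code e) z).isSome = true

/-- The `n`-th stage is the first one at which the program with index `e` is seen to halt below
some `y`. -/
def Expansionary (e n : ℕ) : Prop :=
  ∃ y < n + 1, HaltsBelow e n y ∧ ¬ HaltsBelow e (n - 1) y

theorem primrecPred_haltsBelow :
    PrimrecPred fun a : (ℕ × ℕ) × ℕ => HaltsBelow a.1.1 a.1.2 a.2 := by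
  have h : PrimrecRel fun (z : ℕ) (a : ℕ × ℕ) =>
      (Code.evaln a.2 (Denumerable.ofNat Code a.1) z).isSome = true :=
    Primrec.eq.comp (Primrec.option_isSome.comp (Code.primrec_evaln.comp
      (((Primrec.snd.comp Primrec.snd).pair
        ((Primrec.ofNat Code).comp (Primrec.fst.comp Primrec.snd))).pair Primrec.fst)))
      (Primrec.const true)
  refine ((PrimrecRel.forall_mem_list h).comp
    (Primrec.list_range.comp Primrec.snd) Primrec.fst).of_eq fun a => ?_
  simp [HaltsBelow]

theorem primrecPred_expansionary :
    PrimrecPred fun a : ℕ × ℕ => Expansionary a.1 a.2 := by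
  have h : PrimrecRel fun (y : ℕ) (a : ℕ × ℕ) =>
      HaltsBelow a.1 a.2 y ∧ ¬ HaltsBelow a.1 (a.2 - 1) y :=
    PrimrecPred.and (primrecPred_haltsBelow.comp (Primrec.snd.pair Primrec.fst))
      (PrimrecPred.not (primrecPred_haltsBelow.comp
        (((Primrec.fst.comp Primrec.snd).pair
          (Primrec.pred.comp (Primrec.snd.comp Primrec.snd))).pair Primrec.fst)))
  refine ((PrimrecRel.exists_mem_list h).comp
    (Primrec.list_range.comp (Primrec.succ.comp Primrec.snd)) Primrec.id).of_eq fun a => ?_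
  simp [Expansionary]

theorem HaltsBelow.mono {e n n' y : ℕ} (hn : n ≤ n') (h : HaltsBelow e n y) :
    HaltsBelow e n' y := by
  intro z hz
  obtain ⟨v, hv⟩ := Option.isSome_iff_exists.1 (h z hz)
  exact Option.isSome_iff_exists.2 ⟨v, Code.evaln_mono hn hv⟩

theorem HaltsBelow.le {e n y : ℕ} (h : HaltsBelow e n y) : y ≤ n := by
  by_contra! hlt
  obtain ⟨v, hv⟩ := Option.isSome_iff_exists.1 (h n hlt)
  exact lt_irrefl _ (Code.evaln_bound hv)

theorem exists_forall_expansionary_lt {e z : ℕ}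
    (hz : ¬ (Code.eval (Denumerable.ofNat Code e) z).Dom) :
    ∃ N, ∀ n, Expansionary e n → n < N := by
  have hy : ∀ y, ∃ N, ∀ n, HaltsBelow e n y → ¬ HaltsBelow e (n - 1) y → n < N := by
    intro y
    by_cases h : ∃ n, HaltsBelow e n y
    · obtain ⟨m, hm⟩ := h
      refine ⟨m + 1, fun n _ hn' => ?_⟩
      by_contra! hlt
      exact hn' (hm.mono (by omega))
    · exact ⟨0, fun n hn _ => (h ⟨n, hn⟩).elim⟩
  choose N hN using hy
  refine ⟨(Finset.range (z + 1)).sup N, fun n ⟨y, _, hn, hn'⟩ => ?_⟩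
  have hyz : y ≤ z := by
    by_contra! hlt
    obtain ⟨v, hv⟩ := Option.isSome_iff_exists.1 (hn z hlt)
    exact hz (Part.dom_iff_mem.2 ⟨v, Code.evaln_sound hv⟩)
  exact (hN y n hn hn').trans_le (Finset.le_sup (f := N) (Finset.mem_range.2 (by omega)))

theorem exists_haltsBelow {e : ℕ} (h : ∀ z, (Code.eval (Denumerable.ofNat Code e) z).Dom)
    (y : ℕ) : ∃ n, HaltsBelow e n y := by
  induction y with
  | zero => exact ⟨0, fun z hz => absurd hz (Nat.not_lt_zero z)⟩
  | succ y ih =>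
    obtain ⟨n, hn⟩ := ih
    obtain ⟨v, hv⟩ := Part.dom_iff_mem.1 (h y)
    obtain ⟨k, hk⟩ := Code.evaln_complete.1 hv
    refine ⟨max n k, fun z hz => ?_⟩
    rcases Nat.lt_succ_iff_lt_or_eq.1 hz with hz | rfl
    · exact hn.mono (le_max_left n k) z hz
    · exact Option.isSome_iff_exists.2 ⟨v, Code.evaln_mono (le_max_right n k) hk⟩

theorem frequently_expansionary {e : ℕ}
    (h : ∀ z, (Code.eval (Denumerable.ofNat Code e) z).Dom) :
    ∃ᶠ n in atTop, Expansionary e n := by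
  classical
  rw [frequently_atTop]
  intro a
  have hex := exists_haltsBelow h (a + 1)
  have hspec := Nat.find_spec hex
  have hle := hspec.le
  exact ⟨Nat.find hex, by omega, a + 1, by omega, hspec, Nat.find_min hex (by omega)⟩

/-- There is a partial computable function with domain of density 1 which no total computable
function agrees with on a set of density 1. -/
theorem exists_generically_computable_not_coarsely_computable :
    ∃ ψ : ℕ →. Bool, Partrec ψ ∧ DensityOne (pDom ψ) ∧
      ∀ f : ℕ → Bool, Computable f → ∀ S, DensityOne S → ∃ x ∈ S, (!f x) ∈ ψ x := by
  classical
  let ψ : ℕ →. Bool := fun x =>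
    bif decide (Expansionary (dyadicColumn x) (dyadicBlock x)) then
      (Code.eval (Denumerable.ofNat Code (dyadicColumn x)) x).map fun v => decide (v = 0)
    else Part.some false
  refine ⟨ψ, ?_, ?_, ?_⟩
  · refine Partrec.cond ?_ ?_ (Computable.const false).partrec
    · exact (primrecPred_expansionary.comp
        (primrec_dyadicColumn.pair primrec_dyadicBlock)).decide.to_comp
    · refine Partrec.map (Code.eval_part.comp
        ((Primrec.ofNat Code).comp primrec_dyadicColumn).to_comp Computable.id) ?_
      exact (Primrec.eq.comp Primrec.snd (Primrec.const 0)).decide.to_comp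
  · refine densityOne_of_forall_column fun e => ?_
    by_cases he : ∀ z, (Code.eval (Denumerable.ofNat Code e) z).Dom
    · refine ⟨0, fun x hx hxe => (hx ?_).elim⟩
      by_cases hE : Expansionary (dyadicColumn x) (dyadicBlock x)
      · subst hxe
        simpa [pDom, ψ, hE] using he x
      · simp [pDom, ψ, hE]
    · obtain ⟨z, hz⟩ := not_forall.1 he
      obtain ⟨N, hN⟩ := exists_forall_expansionary_lt hz
      refine ⟨N, fun x hx hxe => hN _ ?_⟩
      by_contra hE
      exact hx (by simp [pDom, ψ, hxe, hE])
  · intro f hf S hS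
    obtain ⟨c, hc⟩ := Code.exists_code.1 (Partrec.nat_iff.1 (Computable.encode.comp hf).partrec)
    have hc' : ∀ x, Code.eval (Denumerable.ofNat Code (encode c)) x = Part.some (encode (f x)) := by
      intro x
      rw [Denumerable.ofNat_encode, hc]
      rfl
    obtain ⟨n, hn, x, hxS, hxe, hxn⟩ := ((frequently_expansionary (e := encode c)
      fun z => by rw [hc']; trivial).and_eventually
        (hS.eventually_exists_mem (encode c))).exists
    refine ⟨x, hxS, ?_⟩
    have : ψ x = Part.some (!f x) := by
      simp only [ψ, hxe, hxn, hn, hc', decide_true, cond_true, Part.map_some]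
      cases f x <;> simp
    simp [this]

/-- The enumeration of axioms `({x ∉ A}, x, false)` for all `x`, and `({x ∈ A}, x, b)` for the
graph of the function computed by `c`. -/
def graphAxioms (c : Code) (k : ℕ) : Option (FinInfo × ℕ × Bool) :=
  Nat.casesOn k.unpair.2 (some ([(k.unpair.1, false)], k.unpair.1, false)) fun s =>
    (Code.evaln s c k.unpair.1).map fun v => ([(k.unpair.1, true)], k.unpair.1, decide (v = 1))

theorem computable_graphAxioms (c : Code) : Computable (graphAxioms c) := by
  have hx : Primrec fun k : ℕ => k.unpair.1 := Primrec.fst.comp Primrec.unpair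
  have hσ : ∀ b : Bool, Primrec fun x : ℕ => ([(x, b)] : List (ℕ × Bool)) := fun b =>
    Primrec.list_cons.comp (Primrec.id.pair (Primrec.const b)) (Primrec.const [])
  refine Primrec.to_comp (Primrec.nat_casesOn (Primrec.snd.comp Primrec.unpair)
    (Primrec.option_some.comp (((hσ false).comp hx).pair (hx.pair (Primrec.const false)))) ?_)
  refine Primrec.option_map (Code.primrec_evaln.comp
    ((Primrec.snd.pair (Primrec.const c)).pair (hx.comp Primrec.fst))) ?_
  have hx' : Primrec fun a : (ℕ × ℕ) × ℕ => a.1.1.unpair.1 :=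
    hx.comp (Primrec.fst.comp Primrec.fst)
  exact ((hσ true).comp hx').pair
    (hx'.pair (Primrec.eq.comp Primrec.snd (Primrec.const 1)).decide)

theorem exists_graphAxioms_eq {ψ : ℕ →. Bool} {c : Code}
    (hc : ∀ x, Code.eval c x = (ψ x).map encode) {σ : FinInfo} {x : ℕ} {b : Bool} :
    (∃ k, graphAxioms c k = some (σ, x, b)) ↔
      (σ = [(x, false)] ∧ b = false) ∨ (σ = [(x, true)] ∧ b ∈ ψ x) := by
  constructor
  · rintro ⟨k, hk⟩
    unfold graphAxioms at hk
    rcases hs : k.unpair.2 with _ | s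
    · simp only [hs] at hk
      cases hk
      simp
    · simp only [hs, Option.map_eq_some_iff, Prod.mk.injEq] at hk
      obtain ⟨v, hv, rfl, rfl, rfl⟩ := hk
      have := Code.evaln_sound hv
      rw [hc, Part.mem_map_iff] at this
      obtain ⟨b, hb, rfl⟩ := this
      right
      cases b <;> simpa using hb
  · rintro (⟨rfl, rfl⟩ | ⟨rfl, hb⟩)
    · exact ⟨Nat.pair x 0, by simp [graphAxioms]⟩
    · obtain ⟨s, hs⟩ := Code.evaln_complete.1
        (show encode b ∈ Code.eval c x by rw [hc]; exact Part.mem_map _ hb)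
      refine ⟨Nat.pair x (s + 1), ?_⟩
      rw [Option.mem_def] at hs
      simp only [graphAxioms, Nat.unpair_pair, hs, Option.map_some]
      cases b <;> simp

/-- A partial computable function whose domain has density 1 is, as a set, generically reducible
to its domain. -/
theorem genericRed_pDom {ψ : ℕ →. Bool} (hψ : Partrec ψ) :
    GenericRed {x | true ∈ ψ x} (pDom ψ) := by
  obtain ⟨c, hc⟩ := Code.exists_code.1
    (Partrec.nat_iff.1 (Partrec.map_encode_iff.2 hψ))
  replace hc : ∀ x, Code.eval c x = (ψ x).map encode := fun x => by rw [hc]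
  let Φ : TuringFunctional :=
    { axs := graphAxioms c
      axs_computable := computable_graphAxioms c
      consistent := by
        intro k₁ k₂ σ₁ σ₂ n b₁ b₂ h₁ h₂ hσ
        rcases (exists_graphAxioms_eq hc).1 ⟨k₁, h₁⟩ with ⟨rfl, rfl⟩ | ⟨rfl, hb₁⟩ <;>
          rcases (exists_graphAxioms_eq hc).1 ⟨k₂, h₂⟩ with ⟨rfl, rfl⟩ | ⟨rfl, hb₂⟩
        · rfl
        · simp [FinInfo.Compatible] at hσ
        · simp [FinInfo.Compatible] at hσ
        · exact Part.mem_unique hb₁ hb₂ }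
  have hT : ∀ C n b, Φ.HaltsT C n b ↔ (n ∉ C ∧ b = false) ∨ (n ∈ C ∧ b ∈ ψ n) := by
    intro C n b
    unfold TuringFunctional.HaltsT
    rw [exists_comm]
    simp only [exists_and_right, Φ, exists_graphAxioms_eq hc, or_and_right, exists_or]
    simp [AgreesSet, and_comm]
  have hP : ∀ g n b, Φ.HaltsP g n b ↔ (false ∈ g n ∧ b = false) ∨ (true ∈ g n ∧ b ∈ ψ n) := by
    intro g n b
    unfold TuringFunctional.HaltsP
    rw [exists_comm]
    simp only [exists_and_right, Φ, exists_graphAxioms_eq hc, or_and_right, exists_or]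
    simp [AgreesPart, and_comm]
  refine ⟨Φ, ⟨fun n => ?_, fun n b hb => ?_⟩, fun g hg hgd => ⟨fun n b hb => ?_, ?_⟩⟩
  · by_cases hn : n ∈ pDom ψ
    · obtain ⟨b, hb⟩ := Part.dom_iff_mem.1 hn
      exact ⟨b, (hT ..).2 (Or.inr ⟨hn, hb⟩)⟩
    · exact ⟨false, (hT ..).2 (Or.inl ⟨hn, rfl⟩)⟩
  · rcases (hT ..).1 hb with ⟨hn, rfl⟩ | ⟨hn, hb⟩
    · simpa using fun h => hn (Part.dom_iff_mem.2 ⟨_, h⟩)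
    · exact ⟨fun h => h ▸ hb, fun h => Part.mem_unique hb h⟩
  · rcases (hP ..).1 hb with ⟨hn, rfl⟩ | ⟨hn, hb⟩
    · simpa using fun h => (by simpa using hg n _ hn : n ∉ pDom ψ) (Part.dom_iff_mem.2 ⟨_, h⟩)
    · exact ⟨fun h => h ▸ hb, fun h => Part.mem_unique hb h⟩
  · convert hgd using 1
    ext n
    constructor
    · rintro ⟨b, hb⟩
      rcases (hP ..).1 hb with ⟨hn, -⟩ | ⟨hn, -⟩ <;> exact Part.dom_iff_mem.2 ⟨_, hn⟩
    · intro hn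
      obtain ⟨b, hb⟩ := Part.dom_iff_mem.1 hn
      cases b with
      | false => exact ⟨false, (hP ..).2 (Or.inl ⟨hb, rfl⟩)⟩
      | true =>
        obtain ⟨b', hb'⟩ := Part.dom_iff_mem.1 ((hg n true hb).1 rfl)
        exact ⟨b', (hP ..).2 (Or.inr ⟨hb, hb'⟩)⟩

/-- A functional which is total on the oracle `ℕ` computes a total computable function from it. -/
theorem TuringFunctional.TotalOn.exists_computable {Φ : TuringFunctional}
    (h : Φ.TotalOn Set.univ) :
    ∃ f : ℕ → Bool, Computable f ∧ ∀ n b, Φ.HaltsT Set.univ n b → b = f n := by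
  classical
  have huniq : ∀ n b b', Φ.HaltsT Set.univ n b → Φ.HaltsT Set.univ n b' → b = b' := by
    rintro n b b' ⟨k, σ, hk, hσ⟩ ⟨k', σ', hk', hσ'⟩
    refine Φ.consistent k k' σ σ' n b b' hk hk' fun p hp q hq _ => ?_
    rw [(hσ p hp).2 trivial, (hσ' q hq).2 trivial]
  let s : ℕ → ℕ → Option Bool := fun n k => (Φ.axs k).bind fun a =>
    bif decide (a.2.1 = n ∧ ∀ p ∈ a.1, p.2 = true) then some a.2.2 else none
  have hs : ∀ n b, (∃ k, b ∈ s n k) ↔ Φ.HaltsT Set.univ n b := by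
    intro n b
    refine exists_congr fun k => ?_
    simp only [s, Option.mem_def, Option.bind_eq_some_iff, AgreesSet, Set.mem_univ, iff_true]
    constructor
    · rintro ⟨⟨σ, m, b'⟩, hk, hb⟩
      by_cases hd : m = n ∧ ∀ p ∈ σ, p.2 = true
      · obtain ⟨rfl, hσ⟩ := hd
        have : b' = b := by
          simpa only [true_and, decide_eq_true hσ, cond_true, Option.some.injEq] using hb
        exact ⟨σ, this ▸ hk, hσ⟩
      · simp only [hd, decide_false, cond_false, reduceCtorEq] at hb
    · rintro ⟨σ, hk, hσ⟩
      exact ⟨_, hk, by simp only [true_and, decide_eq_true hσ, cond_true]⟩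
  have hscomp : Computable₂ s := by
    refine Computable.option_bind (Φ.axs_computable.comp Computable.snd) ?_
    have hall : PrimrecPred fun L : FinInfo => ∀ p ∈ L, p.2 = true :=
      PrimrecPred.forall_mem_list (Primrec.eq.comp Primrec.snd (Primrec.const true))
    have hdec : PrimrecPred fun a : (ℕ × ℕ) × FinInfo × ℕ × Bool =>
        a.2.2.1 = a.1.1 ∧ ∀ p ∈ a.2.1, p.2 = true :=
      PrimrecPred.and (Primrec.eq.comp (Primrec.fst.comp (Primrec.snd.comp Primrec.snd))
        (Primrec.fst.comp Primrec.fst)) (hall.comp (Primrec.fst.comp Primrec.snd))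
    exact (Primrec.cond hdec.decide
      (Primrec.option_some.comp (Primrec.snd.comp (Primrec.snd.comp Primrec.snd)))
      (Primrec.const none)).to_comp
  choose f hf using h
  refine ⟨f, Partrec.of_eq (Partrec.rfindOpt hscomp) fun n => ?_,
    fun n b hb => huniq _ _ _ hb (hf n)⟩
  obtain ⟨k, hk⟩ := (hs n (f n)).2 (hf n)
  obtain ⟨b, hb⟩ := Part.dom_iff_mem.1 (Nat.rfindOpt_dom.2 ⟨k, _, hk⟩)
  have hbf : b = f n := huniq _ _ _ ((hs n b).1 (Nat.rfindOpt_spec hb)) (hf n)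
  exact Part.eq_some_iff.2 (hbf ▸ hb)

theorem exists_generic_red_not_coarse_red :
    ∃ A B : Set ℕ, GenericRed B A ∧ ¬ CoarseRed B A := by
  obtain ⟨ψ, hψ, hdom, hdiag⟩ := exists_generically_computable_not_coarsely_computable
  refine ⟨pDom ψ, {x | true ∈ ψ x}, genericRed_pDom hψ, fun ⟨Φ, hΦ⟩ => ?_⟩
  obtain ⟨htot, hagree⟩ := hΦ Set.univ (by simpa using hdom)
  obtain ⟨f, hf, hfΦ⟩ := htot.exists_computable
  obtain ⟨x, ⟨b, hb, hbB⟩, hx⟩ := hdiag f hf _ hagree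
  obtain rfl := hfΦ x b hb
  cases hfx : f x with
  | false => simp [hfx] at hx hbB; exact hbB hx
  | true =>
    simp only [hfx, true_iff, Set.mem_ofPred_eq] at hx hbB
    exact absurd (Part.mem_unique hx hbB) (by simp)
end
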